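/- Let a, b > 0, Ω > 0, let (Z,θ) be a probability space, and let f : Z → (0,∞) be a measurable function such that θ(Z ∖ Z_τ) ≤ τ for every τ ∈ (0,1], where Z_τ = {z ∈ Z : f(z) ≥ a·τ^b}. Then ∫_Z log(Ω + f(z)^{-1}) dθ(z) ≤ log(Ω + a^{-1}) + 10b. -/

import Mathlib

open MeasureTheory

/-- A nonnegative random variable with tail at most `exp (-t)` is integrable with mean at most `1`. -/
lemma integrable_and_integral_le_one_of_exp_tail {Z : Type*} [MeasurableSpace Z] (θ : Measure Z)
    (g : Z → ℝ) (hg : Measurable g) (hg0 : ∀ z, 0 ≤ g z)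
    (htail : ∀ t : ℝ, 0 < t → θ {z | t < g z} ≤ ENNReal.ofReal (Real.exp (-t))) :
    Integrable g θ ∧ ∫ z, g z ∂θ ≤ 1 := by
  have hexp : ∫⁻ t in Set.Ioi (0 : ℝ), ENNReal.ofReal (Real.exp (-t)) = 1 := by
    rw [← ofReal_integral_eq_lintegral_ofReal (integrableOn_exp_neg_Ioi 0)
      (Filter.Eventually.of_forall fun t => (Real.exp_pos _).le), integral_exp_neg_Ioi_zero]
    simp
  have hle : ∫⁻ z, ENNReal.ofReal (g z) ∂θ ≤ 1 := by
    rw [lintegral_eq_lintegral_meas_lt θ (Filter.Eventually.of_forall hg0) hg.aemeasurable, ← hexp]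
    exact setLIntegral_mono' measurableSet_Ioi fun t ht => htail t ht
  refine ⟨⟨hg.aestronglyMeasurable, ?_⟩, ?_⟩
  · rw [hasFiniteIntegral_iff_ofReal (Filter.Eventually.of_forall hg0)]
    exact hle.trans_lt ENNReal.one_lt_top
  · rw [integral_eq_lintegral_of_nonneg_ae (Filter.Eventually.of_forall hg0)
      hg.aestronglyMeasurable]
    exact ENNReal.toReal_le_of_le_ofReal zero_le_one (by simpa using hle)

/-- Replacing `x` by `a` in `log (c + x⁻¹)` costs at most the positive part of `log (a / x)`. -/
lemma log_add_inv_le {a c x : ℝ} (ha : 0 < a) (hc : 0 < c) (hx : 0 < x) :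
    Real.log (c + x⁻¹) ≤ Real.log (c + a⁻¹) + max 0 (Real.log (a / x)) := by
  rcases le_total a x with h | h
  · have : Real.log (c + x⁻¹) ≤ Real.log (c + a⁻¹) := by gcongr
    exact this.trans (le_add_of_nonneg_right (le_max_left _ _))
  · have h1 : 1 ≤ a / x := (one_le_div hx).2 h
    have hmul : c + x⁻¹ ≤ (c + a⁻¹) * (a / x) := by
      have : (c + a⁻¹) * (a / x) = c * (a / x) + x⁻¹ := by field_simp
      rw [this]
      nlinarith
    calc Real.log (c + x⁻¹) ≤ Real.log ((c + a⁻¹) * (a / x)) :=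
          Real.log_le_log (by positivity) hmul
      _ = Real.log (c + a⁻¹) + Real.log (a / x) :=
          Real.log_mul (by positivity) (by positivity)
      _ ≤ _ := by gcongr; exact le_max_right _ _

/-- Lemma 15.2: let `a, b > 0`, `Ω > 0`, `(Z, θ)` a probability space and `f : Z → (0,∞)`
measurable such that `θ (Z ∖ Z_τ) ≤ τ` for every `τ ∈ (0,1]`, where
`Z_τ = {z : f z ≥ a · τ ^ b}`. Then `∫ log (Ω + f⁻¹) dθ ≤ log (Ω + a⁻¹) + 10 b`. -/
theorem stmt19 {Z : Type*} [MeasurableSpace Z] (θ : Measure Z) [IsProbabilityMeasure θ]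
    (a b Om : ℝ) (ha : 0 < a) (hb : 0 < b) (hOm : 0 < Om)
    (f : Z → ℝ) (hf : Measurable f) (hfpos : ∀ z, 0 < f z)
    (htail : ∀ τ : ℝ, τ ∈ Set.Ioc (0 : ℝ) 1 →
      θ {z | z ∉ {z | a * τ ^ b ≤ f z}} ≤ ENNReal.ofReal τ) :
    ∫ z, Real.log (Om + (f z)⁻¹) ∂θ ≤ Real.log (Om + a⁻¹) + 10 * b := by
  set g : Z → ℝ := fun z => max 0 (Real.log (a / f z)) / b with hgdef
  have hgm : Measurable g := by fun_prop
  have hg0 : ∀ z, 0 ≤ g z := fun z => div_nonneg (le_max_left _ _) hb.le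
  obtain ⟨hgi, hg1⟩ := integrable_and_integral_le_one_of_exp_tail θ g hgm hg0 (by
    intro t ht
    refine (measure_mono ?_).trans
      (htail (Real.exp (-t)) ⟨Real.exp_pos _, Real.exp_le_one_iff.2 (by linarith)⟩)
    intro z hz
    simp only [Set.mem_ofPred_eq, not_le, hgdef] at hz ⊢
    rw [lt_div_iff₀ hb, lt_max_iff] at hz
    have hlog : t * b < Real.log (a / f z) := hz.resolve_left (by nlinarith)
    rw [Real.lt_log_iff_exp_lt (div_pos ha (hfpos z)), lt_div_iff₀ (hfpos z)] at hlog
    rw [← Real.exp_mul, neg_mul, Real.exp_neg, ← div_eq_mul_inv, lt_div_iff₀ (Real.exp_pos _)]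
    linarith)
  have hbound : ∀ z, Real.log (Om + (f z)⁻¹) ≤ Real.log (Om + a⁻¹) + b * g z := fun z => by
    have : b * g z = max 0 (Real.log (a / f z)) := mul_div_cancel₀ _ hb.ne'
    rw [this]
    exact log_add_inv_le ha hOm (hfpos z)
  have hupper : Integrable (fun z => Real.log (Om + a⁻¹) + b * g z) θ :=
    (integrable_const _).add (hgi.const_mul b)
  have hint : Integrable (fun z => Real.log (Om + (f z)⁻¹)) θ := by
    refine integrable_of_le_of_le (g₁ := fun _ => Real.log Om)
      (hf.inv.const_add Om).log.aestronglyMeasurable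
      (Filter.Eventually.of_forall fun z => ?_) (Filter.Eventually.of_forall hbound)
      (integrable_const _) hupper
    exact Real.log_le_log hOm (le_add_of_nonneg_right (inv_pos.2 (hfpos z)).le)
  calc ∫ z, Real.log (Om + (f z)⁻¹) ∂θ
      ≤ ∫ z, (Real.log (Om + a⁻¹) + b * g z) ∂θ := integral_mono hint hupper hbound
    _ = Real.log (Om + a⁻¹) + b * ∫ z, g z ∂θ := by
        rw [integral_add (integrable_const _) (hgi.const_mul b), integral_const_mul]
        simp
    _ ≤ Real.log (Om + a⁻¹) + 10 * b := by nlinarith
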